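/- Fix d ≥ 1, a nonempty index type X, and families (ρ_x)_{x∈X}, (σ_x)_{x∈X} of positive definite density matrices on ℂ^d such that D_sup := sup_{x∈X} D(ρ_x‖σ_x) and D̄_sup := sup_{x∈X} D(σ_x‖ρ_x) are both finite, and let B(r) := sup_{x∈X} sup_{α∈(0,1)} ((α−1)/α)·(r − D_α(ρ_x‖σ_x)) for r ≥ 0. Then: (1) B is nonincreasing in r; (2) B(r) = 0 for every r ≥ D_sup; (3) B(0) = D̄_sup. -/

import Mathlib

open Matrix ComplexOrder

/-- Functional calculus for a matrix: apply `f` to the eigenvalues of a Hermitian matrix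
(junk value `0` on non-Hermitian input). -/
noncomputable def matFun {n : Type*} [Fintype n] [DecidableEq n] (f : ℝ → ℝ)
    (A : Matrix n n ℂ) : Matrix n n ℂ :=
  if hA : A.IsHermitian then
    (hA.eigenvectorUnitary : Matrix n n ℂ) *
      Matrix.diagonal (fun i => (f (hA.eigenvalues i) : ℂ)) *
      (hA.eigenvectorUnitary : Matrix n n ℂ)ᴴ
  else 0

/-- Real matrix power `A^t` via functional calculus (with `0^t = 0`). -/
noncomputable def mrpow {n : Type*} [Fintype n] [DecidableEq n]
    (A : Matrix n n ℂ) (t : ℝ) : Matrix n n ℂ :=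
  matFun (fun x => x ^ t) A

/-- Matrix logarithm via functional calculus. -/
noncomputable def mlog {n : Type*} [Fintype n] [DecidableEq n]
    (A : Matrix n n ℂ) : Matrix n n ℂ :=
  matFun Real.log A

/-- The quantum Rényi relative entropy `D_α(ρ‖σ) = (1/(α−1))·log Tr(ρ^α σ^{1−α})`. -/
noncomputable def renyiD {n : Type*} [Fintype n] [DecidableEq n]
    (α : ℝ) (ρ σ : Matrix n n ℂ) : ℝ :=
  (1 / (α - 1)) * Real.log ((mrpow ρ α * mrpow σ (1 - α)).trace.re)

/-- The quantum relative entropy `D(ρ‖σ) = Tr[ρ(log ρ − log σ)]`. -/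
noncomputable def qRelEnt {n : Type*} [Fintype n] [DecidableEq n]
    (ρ σ : Matrix n n ℂ) : ℝ :=
  ((ρ * (mlog ρ - mlog σ)).trace).re

/-- Overlaps of eigenbases. -/
noncomputable def ovl {n : Type*} [Fintype n] [DecidableEq n] {A B : Matrix n n ℂ}
    (hA : A.IsHermitian) (hB : B.IsHermitian) (i j : n) : ℝ :=
  Complex.normSq (((hA.eigenvectorUnitary : Matrix n n ℂ)ᴴ *
    (hB.eigenvectorUnitary : Matrix n n ℂ)) i j)

lemma trace_matFun_mul {n : Type*} [Fintype n] [DecidableEq n] {A B : Matrix n n ℂ}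
    (hA : A.IsHermitian) (hB : B.IsHermitian) (f g : ℝ → ℝ) :
    (matFun f A * matFun g B).trace.re =
      ∑ i, ∑ j, ovl hA hB i j * (f (hA.eigenvalues i) * g (hB.eigenvalues j)) := by
  rw [matFun, matFun, dif_pos hA, dif_pos hB]
  unfold ovl
  set U := (hA.eigenvectorUnitary : Matrix n n ℂ)
  set V := (hB.eigenvectorUnitary : Matrix n n ℂ)
  set W := Uᴴ * V with hW
  have h1 : ∀ D E : Matrix n n ℂ, (U * D * Uᴴ * (V * E * Vᴴ)).trace = (D * W * E * Wᴴ).trace := by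
    intro D E
    have : U * D * Uᴴ * (V * E * Vᴴ) = U * (D * (Uᴴ * V) * E * Vᴴ) := by
      simp only [Matrix.mul_assoc]
    rw [this, Matrix.trace_mul_comm, hW, Matrix.conjTranspose_mul,
      Matrix.conjTranspose_conjTranspose]
    simp only [Matrix.mul_assoc]
  rw [h1, Matrix.trace, Complex.re_sum]
  refine Finset.sum_congr rfl fun i _ => ?_
  rw [Matrix.diag_apply, Matrix.mul_apply, Complex.re_sum]
  refine Finset.sum_congr rfl fun j _ => ?_
  rw [Matrix.mul_diagonal, Matrix.diagonal_mul, Matrix.conjTranspose_apply]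
  simp [Complex.normSq_apply]
  ring

lemma matFun_id {n : Type*} [Fintype n] [DecidableEq n] {A : Matrix n n ℂ}
    (hA : A.IsHermitian) : matFun (fun x => x) A = A := by
  rw [matFun, dif_pos hA]
  conv_rhs => rw [hA.spectral_theorem]
  rfl

lemma matFun_one {n : Type*} [Fintype n] [DecidableEq n] {A : Matrix n n ℂ}
    (hA : A.IsHermitian) : matFun (fun _ => 1) A = 1 := by
  rw [matFun, dif_pos hA]
  simp [← Matrix.star_eq_conjTranspose]

lemma matFun_mul {n : Type*} [Fintype n] [DecidableEq n] {A : Matrix n n ℂ}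
    (hA : A.IsHermitian) (f g : ℝ → ℝ) :
    matFun f A * matFun g A = matFun (fun x => f x * g x) A := by
  rw [matFun, matFun, matFun, dif_pos hA, dif_pos hA, dif_pos hA]
  set U := (hA.eigenvectorUnitary : Matrix n n ℂ) with hU
  have h : Uᴴ * U = 1 := by simp [hU, ← Matrix.star_eq_conjTranspose]
  calc _ = U * (diagonal (fun i => (f (hA.eigenvalues i) : ℂ)) * ((Uᴴ * U) *
        diagonal (fun i => (g (hA.eigenvalues i) : ℂ)))) * Uᴴ := by
        simp only [Matrix.mul_assoc]
    _ = _ := by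
      rw [h, Matrix.one_mul, Matrix.diagonal_mul_diagonal]
      simp

/-- Classical (Nussbaum–Szkoła) data for a pair of states. -/
lemma exists_classical {n : Type*} [Fintype n] [DecidableEq n] {A B : Matrix n n ℂ}
    (hA : A.PosDef) (hB : B.PosDef) (tA : A.trace = 1) (tB : B.trace = 1) :
    ∃ (c a b : n × n → ℝ), (∀ k, 0 ≤ c k) ∧ (∀ k, 0 < a k) ∧ (∀ k, 0 < b k) ∧
      (∑ k, c k * a k = 1) ∧ (∑ k, c k * b k = 1) ∧
      (qRelEnt A B = ∑ k, c k * (a k * (Real.log (a k) - Real.log (b k)))) ∧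
      (qRelEnt B A = ∑ k, c k * (b k * (Real.log (b k) - Real.log (a k)))) ∧
      (∀ α, (mrpow A α * mrpow B (1 - α)).trace.re = ∑ k, c k * (a k ^ α * b k ^ (1 - α))) := by
  have hA' := hA.isHermitian
  have hB' := hB.isHermitian
  have key := trace_matFun_mul hA' hB'
  refine ⟨fun k => ovl hA' hB' k.1 k.2, fun k => hA'.eigenvalues k.1,
    fun k => hB'.eigenvalues k.2, fun k => Complex.normSq_nonneg _,
    fun k => hA.eigenvalues_pos _, fun k => hB.eigenvalues_pos _, ?_, ?_, ?_, ?_, ?_⟩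
  · have := key (fun x => x) (fun _ => 1)
    rw [matFun_id hA', matFun_one hB', Matrix.mul_one, tA] at this
    rw [Fintype.sum_prod_type]
    simpa using this.symm
  · have := key (fun _ => 1) (fun x => x)
    rw [matFun_id hB', matFun_one hA', Matrix.one_mul, tB] at this
    rw [Fintype.sum_prod_type]
    simpa using this.symm
  · have h1 := key (fun x => x * Real.log x) (fun _ => 1)
    have h2 := key (fun x => x) Real.log
    rw [← matFun_mul hA', matFun_id hA', matFun_one hB', Matrix.mul_one] at h1
    rw [matFun_id hA'] at h2
    rw [qRelEnt, mlog, mlog, Matrix.mul_sub, Matrix.trace_sub, Complex.sub_re, h1, h2,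
      Fintype.sum_prod_type, ← Finset.sum_sub_distrib]
    refine Finset.sum_congr rfl fun i _ => ?_
    rw [← Finset.sum_sub_distrib]
    refine Finset.sum_congr rfl fun j _ => ?_
    ring
  · have h1 := key (fun _ => 1) (fun x => x * Real.log x)
    have h2 := key Real.log (fun x => x)
    rw [← matFun_mul hB', matFun_id hB', matFun_one hA', Matrix.one_mul] at h1
    rw [matFun_id hB', Matrix.trace_mul_comm] at h2
    rw [qRelEnt, mlog, mlog, Matrix.mul_sub, Matrix.trace_sub, Complex.sub_re, h1, h2,
      Fintype.sum_prod_type, ← Finset.sum_sub_distrib]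
    refine Finset.sum_congr rfl fun i _ => ?_
    rw [← Finset.sum_sub_distrib]
    refine Finset.sum_congr rfl fun j _ => ?_
    ring
  · intro α
    rw [mrpow, mrpow, key, Fintype.sum_prod_type]

/-- Jensen-type bound. -/
lemma jensen_log {ι : Type*} [Fintype ι] (p y : ι → ℝ) (hp : ∀ k, 0 ≤ p k) (hy : ∀ k, 0 < y k)
    (h1 : ∑ k, p k = 1) : ∑ k, p k * Real.log (y k) ≤ Real.log (∑ k, p k * y k) := by
  have := strictConcaveOn_log_Ioi.concaveOn.le_map_sum (t := Finset.univ) (w := p) (p := y)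
    (fun i _ => hp i) h1 (fun i _ => hy i)
  simpa using this

section classical
variable {ι : Type*} [Fintype ι] (c a b : ι → ℝ)

lemma cl_log_T_ge (hc : ∀ k, 0 ≤ c k) (ha : ∀ k, 0 < a k) (hb : ∀ k, 0 < b k)
    (h1 : ∑ k, c k * b k = 1) (α : ℝ) :
    -(α * ∑ k, c k * (b k * (Real.log (b k) - Real.log (a k)))) ≤
      Real.log (∑ k, c k * (a k ^ α * b k ^ (1 - α))) := by
  have := jensen_log (fun k => c k * b k) (fun k => a k ^ α * b k ^ (-α))
    (fun k => mul_nonneg (hc k) (hb k).le)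
    (fun k => mul_pos (Real.rpow_pos_of_pos (ha k) _) (Real.rpow_pos_of_pos (hb k) _)) h1
  convert this using 1
  · rw [Finset.mul_sum, ← Finset.sum_neg_distrib]
    refine Finset.sum_congr rfl fun k _ => ?_
    rw [Real.log_mul (Real.rpow_pos_of_pos (ha k) _).ne' (Real.rpow_pos_of_pos (hb k) _).ne',
      Real.log_rpow (ha k), Real.log_rpow (hb k)]
    ring
  · congr 1
    refine Finset.sum_congr rfl fun k _ => ?_
    rw [sub_eq_add_neg, Real.rpow_add (hb k), Real.rpow_one]
    ring

lemma cl_D_nonneg (hc : ∀ k, 0 ≤ c k) (ha : ∀ k, 0 < a k) (hb : ∀ k, 0 < b k)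
    (h1 : ∑ k, c k * b k = 1) (h2 : ∑ k, c k * a k = 1) :
    0 ≤ ∑ k, c k * (b k * (Real.log (b k) - Real.log (a k))) := by
  have := cl_log_T_ge c a b hc ha hb h1 1
  simp [h2] at this
  exact this

lemma cl_tendsto (ha : ∀ k, 0 < a k) (hb : ∀ k, 0 < b k)
    (h1 : ∑ k, c k * b k = 1) :
    Filter.Tendsto (fun α : ℝ => -(1 / α) * Real.log (∑ k, c k * (a k ^ α * b k ^ (1 - α))))
      (nhdsWithin 0 (Set.Ioi 0))
      (nhds (∑ k, c k * (b k * (Real.log (b k) - Real.log (a k))))) := by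
  have hT : HasDerivAt (fun α : ℝ => ∑ k, c k * (a k ^ α * b k ^ (1 - α)))
      (∑ k, c k * (b k * (Real.log (a k) - Real.log (b k)))) 0 := by
    apply HasDerivAt.fun_sum
    intro k _
    have e1 : HasDerivAt (fun α : ℝ => a k ^ α) (Real.log (a k)) 0 := by
      simpa using (hasDerivAt_id (0 : ℝ)).const_rpow (ha k)
    have e2 : HasDerivAt (fun α : ℝ => b k ^ (1 - α)) (-(Real.log (b k) * b k)) 0 := by
      simpa using ((hasDerivAt_id (0 : ℝ)).const_sub 1).const_rpow (hb k)
    have := (e1.mul e2).const_mul (c k)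
    refine this.congr_deriv ?_
    simp only [Real.rpow_zero, sub_zero, Real.rpow_one]
    ring
  have h0 : ∑ k, c k * (a k ^ (0 : ℝ) * b k ^ (1 - (0 : ℝ))) = 1 := by simpa using h1
  have hL := hT.log (by rw [h0]; norm_num)
  rw [h0, div_one] at hL
  have hs := (hasDerivAt_iff_tendsto_slope_zero.1 hL).mono_left
    (nhdsWithin_mono 0 (fun x (hx : 0 < x) => hx.ne') : nhdsWithin (0 : ℝ) (Set.Ioi 0) ≤ _)
  have := hs.neg
  convert this using 2
  · rw [h0]
    simp
  · rw [← Finset.sum_neg_distrib]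
    refine Finset.sum_congr rfl fun k _ => ?_
    ring
end classical

/-- Per-pair facts. -/
lemma pair_facts {n : Type*} [Fintype n] [DecidableEq n] {A B : Matrix n n ℂ}
    (hA : A.PosDef) (hB : B.PosDef) (tA : A.trace = 1) (tB : B.trace = 1) :
    0 ≤ qRelEnt A B ∧ 0 ≤ qRelEnt B A ∧
    (∀ α ∈ Set.Ioo (0 : ℝ) 1, ((α - 1) / α) * (0 - renyiD α A B) ≤ qRelEnt B A) ∧
    (∀ α ∈ Set.Ioo (0 : ℝ) 1, renyiD α A B ≤ qRelEnt A B) ∧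
    Filter.Tendsto (fun α : ℝ => ((α - 1) / α) * (0 - renyiD α A B))
      (nhdsWithin 0 (Set.Ioi 0)) (nhds (qRelEnt B A)) := by
  obtain ⟨c, a, b, hc, ha, hb, h1, h2, hD, hD', hT⟩ := exists_classical hA hB tA tB
  have conv : ∀ α ∈ Set.Ioo (0 : ℝ) 1, ((α - 1) / α) * (0 - renyiD α A B) =
      -(1 / α) * Real.log (∑ k, c k * (a k ^ α * b k ^ (1 - α))) := by
    intro α hα
    have e1 : α ≠ 0 := hα.1.ne'
    have e2 : α - 1 ≠ 0 := by linarith [hα.2]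
    rw [renyiD, hT]
    field_simp
    ring
  refine ⟨hD ▸ cl_D_nonneg c b a hc hb ha h1 h2, hD' ▸ cl_D_nonneg c a b hc ha hb h2 h1,
    ?_, ?_, ?_⟩
  · intro α hα
    rw [conv α hα]
    have := cl_log_T_ge c a b hc ha hb h2 α
    rw [← hD'] at this
    have h0 := hα.1
    rw [neg_mul, one_div, ← div_eq_inv_mul, ← neg_div, div_le_iff₀ h0]
    linarith
  · intro α hα
    have := cl_log_T_ge c b a hc hb ha h1 (1 - α)
    rw [← hD] at this
    have e : ∑ k, c k * (b k ^ (1 - α) * a k ^ (1 - (1 - α))) =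
        ∑ k, c k * (a k ^ α * b k ^ (1 - α)) := by
      refine Finset.sum_congr rfl fun k _ => ?_
      rw [sub_sub_cancel, mul_comm (b k ^ (1 - α))]
    rw [e] at this
    have h0 : α - 1 < 0 := by linarith [hα.2]
    rw [renyiD, hT, one_div, ← div_eq_inv_mul, div_le_iff_of_neg h0]
    linarith
  · rw [hD']
    refine (cl_tendsto c a b ha hb h2).congr' ?_
    filter_upwards [Ioo_mem_nhdsGT (zero_lt_one (α := ℝ))] with α hα
    exact (conv α hα).symm

lemma biSup_le' {S : Set ℝ} {f : ℝ → ℝ} {M : ℝ} (hM : 0 ≤ M) (h : ∀ α ∈ S, f α ≤ M) (α : ℝ) :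
    (⨆ (_ : α ∈ S), f α) ≤ M := Real.iSup_le (h α) hM

lemma le_biSup' {S : Set ℝ} {f : ℝ → ℝ} {M : ℝ} (hM : 0 ≤ M) (h : ∀ α ∈ S, f α ≤ M)
    {α : ℝ} (hα : α ∈ S) : f α ≤ ⨆ α ∈ S, f α := by
  have hb : BddAbove (Set.range fun α => ⨆ (_ : α ∈ S), f α) :=
    ⟨M, by rintro _ ⟨β, rfl⟩; exact biSup_le' hM h β⟩
  refine le_trans ?_ (le_ciSup hb α)
  simp [hα]

lemma biSup_nonneg' {f : ℝ → ℝ} {M : ℝ} (hM : 0 ≤ M)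
    (h : ∀ α ∈ Set.Ioo (0 : ℝ) 1, f α ≤ M) : 0 ≤ ⨆ α ∈ Set.Ioo (0 : ℝ) 1, f α := by
  have hb : BddAbove (Set.range fun α => ⨆ (_ : α ∈ Set.Ioo (0 : ℝ) 1), f α) :=
    ⟨M, by rintro _ ⟨β, rfl⟩; exact biSup_le' hM h β⟩
  refine le_trans ?_ (le_ciSup hb 2)
  have : IsEmpty ((2 : ℝ) ∈ Set.Ioo (0 : ℝ) 1) := ⟨fun h => by norm_num at h⟩
  rw [Real.iSup_of_isEmpty]

/-- basic properties of the Hoeffding function: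
it is nonincreasing, vanishes for `r ≥ sup_x D(ρ_x‖σ_x)`, and
`B(0) = sup_x D(σ_x‖ρ_x)`. -/
theorem hoeffding_function_basic_properties
    (d : ℕ) (hd : 1 ≤ d) {X : Type*} [Nonempty X]
    (ρ σ : X → Matrix (Fin d) (Fin d) ℂ)
    (hρ : ∀ x, (ρ x).PosDef ∧ (ρ x).trace = 1)
    (hσ : ∀ x, (σ x).PosDef ∧ (σ x).trace = 1)
    (hDfin : BddAbove (Set.range fun x => qRelEnt (ρ x) (σ x)))
    (hDbfin : BddAbove (Set.range fun x => qRelEnt (σ x) (ρ x)))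
    (B : ℝ → ℝ)
    (hB : ∀ r, B r = ⨆ x : X, ⨆ α ∈ Set.Ioo (0 : ℝ) 1,
      ((α - 1) / α) * (r - renyiD α (ρ x) (σ x))) :
    (∀ r s : ℝ, 0 ≤ r → r ≤ s → B s ≤ B r) ∧
    (∀ r : ℝ, (⨆ x : X, qRelEnt (ρ x) (σ x)) ≤ r → B r = 0) ∧
    B 0 = ⨆ x : X, qRelEnt (σ x) (ρ x) := by
  have F := fun x => pair_facts (hρ x).1 (hσ x).1 (hρ x).2 (hσ x).2
  -- pointwise monotonicity in r
  have mono : ∀ x, ∀ r s : ℝ, r ≤ s → ∀ α ∈ Set.Ioo (0 : ℝ) 1,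
      ((α - 1) / α) * (s - renyiD α (ρ x) (σ x)) ≤
        ((α - 1) / α) * (r - renyiD α (ρ x) (σ x)) := by
    intro x r s hrs α hα
    have : (α - 1) / α ≤ 0 := div_nonpos_of_nonpos_of_nonneg (by linarith [hα.2]) hα.1.le
    exact mul_le_mul_of_nonpos_left (by linarith) this
  have bd : ∀ x, ∀ r : ℝ, 0 ≤ r → ∀ α ∈ Set.Ioo (0 : ℝ) 1,
      ((α - 1) / α) * (r - renyiD α (ρ x) (σ x)) ≤ qRelEnt (σ x) (ρ x) :=
    fun x r hr α hα => (mono x 0 r hr α hα).trans ((F x).2.2.1 α hα)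
  have bdI : ∀ r : ℝ, 0 ≤ r → ∀ x, (⨆ α ∈ Set.Ioo (0 : ℝ) 1,
      ((α - 1) / α) * (r - renyiD α (ρ x) (σ x))) ≤ qRelEnt (σ x) (ρ x) :=
    fun r hr x => ciSup_le fun α => biSup_le' (F x).2.1 (bd x r hr) α
  have bdO : ∀ r : ℝ, 0 ≤ r → BddAbove (Set.range fun x => ⨆ α ∈ Set.Ioo (0 : ℝ) 1,
      ((α - 1) / α) * (r - renyiD α (ρ x) (σ x))) := by
    intro r hr
    obtain ⟨M, hM⟩ := hDbfin
    refine ⟨M, ?_⟩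
    rintro _ ⟨x, rfl⟩
    exact (bdI r hr x).trans (hM ⟨x, rfl⟩)
  have nn : ∀ r : ℝ, 0 ≤ r → ∀ x, 0 ≤ (⨆ α ∈ Set.Ioo (0 : ℝ) 1,
      ((α - 1) / α) * (r - renyiD α (ρ x) (σ x))) :=
    fun r hr x => biSup_nonneg' (F x).2.1 (bd x r hr)
  refine ⟨?_, ?_, ?_⟩
  · intro r s hr hrs
    rw [hB, hB]
    refine ciSup_mono (bdO r hr) fun x => ?_
    refine ciSup_le fun β => Real.iSup_le (fun hβ => ?_) (nn r hr x)
    exact (mono x r s hrs β hβ).trans (le_biSup' (f := fun α => ((α - 1) / α) * (r - renyiD α (ρ x) (σ x))) (F x).2.1 (bd x r hr) hβ)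
  · intro r hr
    have hx : ∀ x, qRelEnt (ρ x) (σ x) ≤ r := fun x => (le_ciSup hDfin x).trans hr
    obtain ⟨x₀⟩ := ‹Nonempty X›
    have hr0 : 0 ≤ r := (F x₀).1.trans (hx x₀)
    rw [hB]
    have : Nonempty X := ⟨x₀⟩
    refine le_antisymm (ciSup_le fun x => ciSup_le fun β => Real.iSup_le (fun hβ => ?_) le_rfl)
      ((nn r hr0 x₀).trans (le_ciSup (bdO r hr0) x₀))
    have h1 : (β - 1) / β ≤ 0 := div_nonpos_of_nonpos_of_nonneg (by linarith [hβ.2]) hβ.1.le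
    exact mul_nonpos_of_nonpos_of_nonneg h1 (by linarith [hx x, (F x).2.2.2.1 β hβ])
  · rw [hB]
    refine le_antisymm (ciSup_mono hDbfin (bdI 0 le_rfl)) (ciSup_mono (bdO 0 le_rfl) fun x => ?_)
    refine le_of_tendsto (F x).2.2.2.2 ?_
    filter_upwards [Ioo_mem_nhdsGT (zero_lt_one (α := ℝ))] with α hα
    exact le_biSup' (F x).2.1 (bd x 0 le_rfl) hα
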